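/- There is no continuous surjective map f from the closed unit disc D = {z ∈ ℂ : ‖z‖ ≤ 1} onto the circle ℝ/πℤ (the space of orientations) such that for every θ ∈ ℝ/πℤ the fiber f⁻¹({θ}) is a connected subset of D. (Equivalently: any exhaustive representation of orientations with geometric redundancy 1 must have a singularity.) -/

import Mathlib

theorem disc_lift (f : {z : ℂ // ‖z‖ ≤ 1} → AddCircle Real.pi) (hf : Continuous f) :
    ∃ g : {z : ℂ // ‖z‖ ≤ 1} → ℝ, Continuous g ∧ ∀ z, ((g z : ℝ) : AddCircle Real.pi) = f z := by
  have hm : ∀ p : unitInterval × {z : ℂ // ‖z‖ ≤ 1}, ‖((p.1 : ℝ) : ℂ) * (p.2 : ℂ)‖ ≤ 1 := by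
    rintro ⟨t, z⟩
    rw [norm_mul, Complex.norm_real, Real.norm_eq_abs, abs_of_nonneg t.2.1]
    exact mul_le_one₀ t.2.2 (norm_nonneg _) z.2
  let H : C(unitInterval × {z : ℂ // ‖z‖ ≤ 1}, AddCircle Real.pi) :=
    ⟨fun p => f ⟨((p.1 : ℝ) : ℂ) * (p.2 : ℂ), hm p⟩, by
      apply hf.comp
      apply Continuous.subtype_mk
      fun_prop⟩
  obtain ⟨e, he⟩ := QuotientAddGroup.mk_surjective (f ⟨0, by simp⟩)
  have h0 : ∀ a, H (0, a) = ((ContinuousMap.const {z : ℂ // ‖z‖ ≤ 1} e a : ℝ) : AddCircle Real.pi) := by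
    intro a
    simp only [ContinuousMap.const_apply]
    refine Eq.trans ?_ he.symm
    simp [H]
  let G := (AddCircle.isCoveringMap_coe Real.pi).liftHomotopy H (ContinuousMap.const _ e) h0
  refine ⟨fun z => G (1, z), by fun_prop, fun z => ?_⟩
  have := congrFun ((AddCircle.isCoveringMap_coe Real.pi).liftHomotopy_lifts H
    (ContinuousMap.const _ e) h0) (1, z)
  refine Eq.trans this ?_
  simp [H]

/-- There is no continuous surjective map from the closed unit disc onto the circle
of orientations `ℝ/πℤ` all of whose fibers are connected (geometric redundancy 1):
any exhaustive redundancy-1 representation of orientations must have a singularity. -/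
theorem no_redundancy_one_orientation_map_on_disc :
    ¬ ∃ f : {z : ℂ // ‖z‖ ≤ 1} → AddCircle Real.pi,
        Continuous f ∧ Function.Surjective f ∧
          ∀ θ : AddCircle Real.pi, IsConnected (f ⁻¹' {θ}) := by
  rintro ⟨f, hf, hs, hc⟩
  obtain ⟨g, hg, hgf⟩ := disc_lift f hf
  have hpi := Real.pi_pos
  have key : ∀ s t : ℝ, ((s : ℝ) : AddCircle Real.pi) = (t : AddCircle Real.pi) →
      t ≤ s → s < t + Real.pi → s = t := by
    intro s t h h1 h2
    have h3 : ((s - t : ℝ) : AddCircle Real.pi) = 0 := by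
      rw [AddCircle.coe_sub, h, sub_self]
    obtain ⟨n, hn⟩ := (AddCircle.coe_eq_zero_iff Real.pi).1 h3
    rw [zsmul_eq_mul] at hn
    have h4 : (n : ℝ) < 1 := by
      by_contra hh
      push Not at hh
      nlinarith
    have h5 : (-1 : ℝ) < n := by
      by_contra hh
      push Not at hh
      nlinarith
    have h6 : n = 0 := by
      have h4' : n < 1 := by exact_mod_cast h4
      have h5' : -1 < n := by exact_mod_cast h5
      omega
    rw [h6] at hn
    simp at hn
    linarith
  have hfib : ∀ x y, g x ≠ g y + Real.pi := by
    intro x y hxy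
    have hfxy : f x = f y := by
      rw [← hgf, ← hgf, hxy, AddCircle.coe_add_period]
    have hp := (hc (f y)).isPreconnected.intermediate_value (f := g) (a := y) (b := x)
      rfl hfxy hg.continuousOn
    obtain ⟨w, hw, hgw⟩ := hp (show g y + Real.pi / 2 ∈ Set.Icc (g y) (g x) from
      ⟨by linarith, by linarith⟩)
    have hw' : f w = f y := hw
    rw [← hgf, ← hgf] at hw'
    have := key _ _ hw' (by linarith) (by linarith)
    linarith
  have hball : {z : ℂ | ‖z‖ ≤ 1} = Metric.closedBall (0 : ℂ) 1 := by
    ext z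
    simp
  have hcpt : CompactSpace {z : ℂ // ‖z‖ ≤ 1} := by
    have h : IsCompact {z : ℂ | ‖z‖ ≤ 1} := by
      rw [hball]
      exact isCompact_closedBall (0 : ℂ) 1
    exact isCompact_iff_compactSpace.1 h
  have hpre : PreconnectedSpace {z : ℂ // ‖z‖ ≤ 1} := by
    have h : IsPreconnected {z : ℂ | ‖z‖ ≤ 1} := by
      rw [hball]
      exact (convex_closedBall (0 : ℂ) 1).isPreconnected
    exact Subtype.preconnectedSpace h
  obtain ⟨a, -, ha⟩ := isCompact_univ.exists_isMinOn (s := Set.univ)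
    ⟨(⟨0, by simp⟩ : {z : ℂ // ‖z‖ ≤ 1}), trivial⟩ hg.continuousOn
  obtain ⟨b, -, hb⟩ := isCompact_univ.exists_isMaxOn (s := Set.univ)
    ⟨(⟨0, by simp⟩ : {z : ℂ // ‖z‖ ≤ 1}), trivial⟩ hg.continuousOn
  have ha' : ∀ x, g a ≤ g x := fun x => ha (Set.mem_univ x)
  have hb' : ∀ x, g x ≤ g b := fun x => hb (Set.mem_univ x)
  have hlt : g b < g a + Real.pi := by
    by_contra hh
    push Not at hh
    obtain ⟨w, hw⟩ := intermediate_value_univ a b hg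
      (show g a + Real.pi ∈ Set.Icc (g a) (g b) from ⟨by linarith, hh⟩)
    exact hfib w a hw
  obtain ⟨x, hx⟩ := hs (((g b + (g a + Real.pi)) / 2 : ℝ) : AddCircle Real.pi)
  rw [← hgf] at hx
  have h1 := ha' x
  have h2 := hb' x
  have := key _ _ hx.symm (by linarith) (by linarith)
  linarith
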